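/- arXiv:2212.03820 — 2 statements merged into one kernel-verified Lean document; each statement's English description precedes it below -/
import Mathlib

section
/- Let B be an n×n complex matrix such that the restriction of B to every coordinate subspace L of ℂ^n with dim L ≤ rank B is injective. Then for every positive semidefinite diagonal n×n matrix X, rank(B X B*) = min{rank X, rank B}. -/
open Matrix

/-- The span of the standard basis vectors indexed by `t` has dimension `t.card`. -/
theorem finrank_span_single_image {K ι : Type*} [Field K] [Fintype ι] [DecidableEq ι]
    (t : Finset ι) :
    Module.finrank K
      (Submodule.span K ((fun i : ι => (Pi.single i 1 : ι → K)) '' ↑t)) = t.card := by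
  have h : LinearIndependent K (fun i : ι => (Pi.single i 1 : ι → K)) :=
    Pi.linearIndependent_single_one ι K
  have hcard := finrank_span_eq_card (h.comp (Subtype.val : t → ι) Subtype.val_injective)
  have hrange : Set.range (Subtype.val : t → ι) = ↑t := Subtype.range_coe
  rwa [Fintype.card_coe, Set.range_comp, hrange] at hcard

/-- If `A` is injective on a coordinate subspace on whose index set `e` does not vanish, then
`A * diagonal e` has rank at least the dimension of that subspace. -/
theorem card_le_rank_mul_diagonal {K m ι : Type*} [Field K] [Fintype m] [Fintype ι]
    [DecidableEq ι] (A : Matrix m ι K) (e : ι → K) (t : Finset ι) (he : ∀ i ∈ t, e i ≠ 0)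
    (hA : Set.InjOn A.mulVec
      ↑(Submodule.span K ((fun i : ι => (Pi.single i 1 : ι → K)) '' ↑t))) :
    t.card ≤ (A * Matrix.diagonal e).rank := by
  set W := Submodule.span K ((fun i : ι => (Pi.single i 1 : ι → K)) '' ↑t) with hW
  have hinj : Function.Injective (A.mulVecLin.domRestrict W) := fun x y hxy =>
    Subtype.ext (hA x.2 y.2 hxy)
  rw [← finrank_span_single_image (K := K) t, ← LinearMap.finrank_range_of_inj hinj,
    LinearMap.range_domRestrict, Matrix.rank]
  refine Submodule.finrank_mono ?_
  rw [hW, Submodule.map_span_le]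
  rintro _ ⟨i, hi, rfl⟩
  refine ⟨Pi.single i (e i)⁻¹, ?_⟩
  simp only [Matrix.mulVecLin_apply, ← Matrix.mulVec_mulVec, Matrix.diagonal_mulVec_single,
    mul_inv_cancel₀ (he i hi)]

theorem stmt3 (n : ℕ) (B : Matrix (Fin n) (Fin n) ℂ)
    (hB : ∀ t : Finset (Fin n),
      Module.finrank ℂ
        (Submodule.span ℂ ((fun i : Fin n => Pi.single i (1 : ℂ)) '' ↑t)) ≤ B.rank →
      Set.InjOn B.mulVec
        ↑(Submodule.span ℂ ((fun i : Fin n => Pi.single i (1 : ℂ)) '' ↑t)))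
    (d : Fin n → ℝ) (hd : ∀ i, 0 ≤ d i) :
    (B * Matrix.diagonal (fun i => (d i : ℂ)) * Bᴴ).rank =
      min (Matrix.diagonal (fun i => (d i : ℂ))).rank B.rank := by
  refine le_antisymm (le_min ?_ ?_) ?_
  · exact (Matrix.rank_mul_le_left _ _).trans (Matrix.rank_mul_le_right _ _)
  · exact (Matrix.rank_mul_le_left _ _).trans (Matrix.rank_mul_le_left _ _)
  · set e : Fin n → ℂ := fun i => ((√(d i) : ℝ) : ℂ) with he
    have hfac : B * Matrix.diagonal (fun i => (d i : ℂ)) * Bᴴ =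
        (B * Matrix.diagonal e) * (B * Matrix.diagonal e)ᴴ := by
      have hstar : star e = e := by
        ext i
        simp [he]
      have hsq : (fun i => (d i : ℂ)) = fun i => e i * e i := by
        ext i
        rw [he, ← Complex.ofReal_mul, Real.mul_self_sqrt (hd i)]
      rw [Matrix.conjTranspose_mul, Matrix.diagonal_conjTranspose, hstar, hsq,
        ← Matrix.diagonal_mul_diagonal]
      simp only [Matrix.mul_assoc]
    have hrank := open scoped ComplexOrder in
      Matrix.rank_self_mul_conjTranspose (B * Matrix.diagonal e)
    rw [hfac, hrank, Matrix.rank_diagonal, Fintype.card_subtype]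
    obtain ⟨t, hts, htc⟩ := Finset.exists_subset_card_eq
      (min_le_left (Finset.univ.filter fun i => (d i : ℂ) ≠ 0).card B.rank)
    rw [← htc]
    refine card_le_rank_mul_diagonal B e t (fun i hi => ?_) (hB t ?_)
    · have hdi : d i ≠ 0 := by simpa using hts hi
      exact Complex.ofReal_ne_zero.mpr
        (Real.sqrt_ne_zero'.mpr (lt_of_le_of_ne (hd i) hdi.symm))
    · rw [finrank_span_single_image, htc]
      exact min_le_right _ _
end

section
/- Let B be an n×n complex matrix such that for every positive semidefinite diagonal n×n matrix X one has rank(B X B*) = min{rank X, rank B}. Then every set of rank(B)-many distinct columns of B is linearly independent. -/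
open Matrix

/-- Weighting by the indicator of `s` keeps exactly the columns indexed by `s`. -/
lemma mul_diagonal_indicator_mul_conjTranspose {n : ℕ} (B : Matrix (Fin n) (Fin n) ℂ)
    (s : Finset (Fin n)) :
    B * Matrix.diagonal (fun i => (((if i ∈ s then 1 else 0 : ℝ)) : ℂ)) * Bᴴ =
      B.submatrix id (fun j : s => (j : Fin n)) *
        (B.submatrix id (fun j : s => (j : Fin n)))ᴴ := by
  ext i k
  rw [Matrix.mul_apply, Matrix.mul_apply]
  simp only [Matrix.mul_diagonal, conjTranspose_apply, submatrix_apply, id]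
  rw [Finset.sum_coe_sort s (fun j => B i j * star (B k j)),
    ← Finset.sum_subset (Finset.subset_univ s)]
  · exact Finset.sum_congr rfl fun j hj => by simp [hj]
  · intro j _ hj
    simp [hj]

lemma rank_diagonal_indicator {n : ℕ} (s : Finset (Fin n)) :
    (Matrix.diagonal (fun i => (((if i ∈ s then 1 else 0 : ℝ)) : ℂ))).rank = s.card := by
  simp [Matrix.rank_diagonal]

theorem stmt4 (n : ℕ) (B : Matrix (Fin n) (Fin n) ℂ)
    (hB : ∀ d : Fin n → ℝ, (∀ i, 0 ≤ d i) →
      (B * Matrix.diagonal (fun i => (d i : ℂ)) * Bᴴ).rank =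
        min (Matrix.diagonal (fun i => (d i : ℂ))).rank B.rank) :
    ∀ s : Finset (Fin n), s.card = B.rank →
      LinearIndependent ℂ (fun j : s => B.transpose (j : Fin n)) := by
  intro s hs
  have h := hB (fun i => if i ∈ s then 1 else 0) fun i => by positivity
  rw [mul_diagonal_indicator_mul_conjTranspose, rank_diagonal_indicator, ← hs, min_self] at h
  have hle := h.symm.trans_le (Matrix.rank_mul_le_left _ _)
  rw [Matrix.rank_eq_finrank_span_cols] at hle
  rw [linearIndependent_iff_card_le_finrank_span, Fintype.card_coe]
  exact hle
end
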